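/- Let e ⊥ 1 be a unit octonion, and let L, F : O → O be R-linear maps satisfying (Ye)·L(Y) = Y·F(Y) for all Y ∈ O. Then there exist octonions a, b, p such that L(Y) = ⟨a,Y⟩·1 + ⟨b,Y⟩·e + Y*·p for all Y. -/

import Mathlib

noncomputable section
open RealInnerProductSpace

abbrev Oct : Type := Quaternion ℝ × Quaternion ℝ

/-- Cayley–Dickson octonion multiplication on pairs of quaternions. -/
def omul (x y : Oct) : Oct :=
  (x.1 * y.1 - star y.2 * x.2, y.2 * x.1 + x.2 * star y.1)

def oone : Oct := (1, 0)

/-- The standard inner product on the octonions. -/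
def oinner (x y : Oct) : ℝ := ⟪x.1, y.1⟫ + ⟪x.2, y.2⟫

/-- Octonion conjugation: x* = 2⟨x,1⟩1 − x. -/
def oconj (x : Oct) : Oct := (2 * oinner x oone) • oone - x

set_option linter.unusedSimpArgs false
set_option linter.unreachableTactic false

def asc (x y z : Oct) : Oct := omul (omul x y) z - omul x (omul y z)

/-- The octonion with the given coordinates. -/
def mkO (a0 a1 a2 a3 a4 a5 a6 a7 : ℝ) : Oct := (⟨a0, a1, a2, a3⟩, ⟨a4, a5, a6, a7⟩)

theorem mkO_eta (x : Oct) : ∃ a0 a1 a2 a3 a4 a5 a6 a7, x = mkO a0 a1 a2 a3 a4 a5 a6 a7 :=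
  ⟨x.1.re, x.1.imI, x.1.imJ, x.1.imK, x.2.re, x.2.imI, x.2.imJ, x.2.imK, rfl⟩

theorem mkO_congr {a0 a1 a2 a3 a4 a5 a6 a7 b0 b1 b2 b3 b4 b5 b6 b7 : ℝ}
    (h0 : a0 = b0) (h1 : a1 = b1) (h2 : a2 = b2) (h3 : a3 = b3) (h4 : a4 = b4) (h5 : a5 = b5) (h6 : a6 = b6) (h7 : a7 = b7) :
    mkO a0 a1 a2 a3 a4 a5 a6 a7 = mkO b0 b1 b2 b3 b4 b5 b6 b7 := by
  subst h0 h1 h2 h3 h4 h5 h6 h7; rfl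

theorem mkO_zero : (0 : Oct) = mkO 0 0 0 0 0 0 0 0 := rfl

theorem mkO_one : oone = mkO 1 0 0 0 0 0 0 0 := rfl

theorem mkO_add (a0 a1 a2 a3 a4 a5 a6 a7 b0 b1 b2 b3 b4 b5 b6 b7 : ℝ) : mkO a0 a1 a2 a3 a4 a5 a6 a7 + mkO b0 b1 b2 b3 b4 b5 b6 b7 =
    mkO (a0 + b0) (a1 + b1) (a2 + b2) (a3 + b3) (a4 + b4) (a5 + b5) (a6 + b6) (a7 + b7) := rfl

theorem mkO_sub (a0 a1 a2 a3 a4 a5 a6 a7 b0 b1 b2 b3 b4 b5 b6 b7 : ℝ) : mkO a0 a1 a2 a3 a4 a5 a6 a7 - mkO b0 b1 b2 b3 b4 b5 b6 b7 =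
    mkO (a0 - b0) (a1 - b1) (a2 - b2) (a3 - b3) (a4 - b4) (a5 - b5) (a6 - b6) (a7 - b7) := rfl

theorem mkO_smul (r a0 a1 a2 a3 a4 a5 a6 a7 : ℝ) : r • mkO a0 a1 a2 a3 a4 a5 a6 a7 =
    mkO (r * a0) (r * a1) (r * a2) (r * a3) (r * a4) (r * a5) (r * a6) (r * a7) := rfl

theorem oinner_eq (x y : Oct) : oinner x y =
    x.1.re * y.1.re + x.1.imI * y.1.imI + x.1.imJ * y.1.imJ + x.1.imK * y.1.imK + x.2.re * y.2.re + x.2.imI * y.2.imI + x.2.imJ * y.2.imJ + x.2.imK * y.2.imK := by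
  simp [oinner, Quaternion.inner_def]; ring

theorem mkO_inner (a0 a1 a2 a3 a4 a5 a6 a7 b0 b1 b2 b3 b4 b5 b6 b7 : ℝ) : oinner (mkO a0 a1 a2 a3 a4 a5 a6 a7) (mkO b0 b1 b2 b3 b4 b5 b6 b7) =
    a0 * b0 + a1 * b1 + a2 * b2 + a3 * b3 + a4 * b4 + a5 * b5 + a6 * b6 + a7 * b7 := oinner_eq _ _

theorem omul_eq (x y : Oct) : omul x y =
    mkO (x.1.re * y.1.re - x.1.imI * y.1.imI - x.1.imJ * y.1.imJ - x.1.imK * y.1.imK - y.2.re * x.2.re - y.2.imI * x.2.imI - y.2.imJ * x.2.imJ - y.2.imK * x.2.imK)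
      (x.1.re * y.1.imI + x.1.imI * y.1.re + x.1.imJ * y.1.imK + y.2.imI * x.2.re + y.2.imJ * x.2.imK - x.1.imK * y.1.imJ - y.2.re * x.2.imI - y.2.imK * x.2.imJ)
      (x.1.re * y.1.imJ + x.1.imJ * y.1.re + x.1.imK * y.1.imI + y.2.imJ * x.2.re + y.2.imK * x.2.imI - x.1.imI * y.1.imK - y.2.re * x.2.imJ - y.2.imI * x.2.imK)
      (x.1.re * y.1.imK + x.1.imI * y.1.imJ + x.1.imK * y.1.re + y.2.imI * x.2.imJ + y.2.imK * x.2.re - x.1.imJ * y.1.imI - y.2.re * x.2.imK - y.2.imJ * x.2.imI)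
      (y.2.re * x.1.re + x.2.re * y.1.re + x.2.imI * y.1.imI + x.2.imJ * y.1.imJ + x.2.imK * y.1.imK - y.2.imI * x.1.imI - y.2.imJ * x.1.imJ - y.2.imK * x.1.imK)
      (y.2.re * x.1.imI + y.2.imI * x.1.re + y.2.imJ * x.1.imK + x.2.imI * y.1.re + x.2.imK * y.1.imJ - y.2.imK * x.1.imJ - x.2.re * y.1.imI - x.2.imJ * y.1.imK)
      (y.2.re * x.1.imJ + y.2.imJ * x.1.re + y.2.imK * x.1.imI + x.2.imI * y.1.imK + x.2.imJ * y.1.re - y.2.imI * x.1.imK - x.2.re * y.1.imJ - x.2.imK * y.1.imI)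
      (y.2.re * x.1.imK + y.2.imI * x.1.imJ + y.2.imK * x.1.re + x.2.imJ * y.1.imI + x.2.imK * y.1.re - y.2.imJ * x.1.imI - x.2.re * y.1.imK - x.2.imI * y.1.imJ) := by
  apply Prod.ext <;> apply Quaternion.ext <;> simp [omul, mkO] <;> ring

theorem mkO_mul (a0 a1 a2 a3 a4 a5 a6 a7 b0 b1 b2 b3 b4 b5 b6 b7 : ℝ) : omul (mkO a0 a1 a2 a3 a4 a5 a6 a7) (mkO b0 b1 b2 b3 b4 b5 b6 b7) =
    mkO (a0 * b0 - a1 * b1 - a2 * b2 - a3 * b3 - b4 * a4 - b5 * a5 - b6 * a6 - b7 * a7)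
      (a0 * b1 + a1 * b0 + a2 * b3 + b5 * a4 + b6 * a7 - a3 * b2 - b4 * a5 - b7 * a6)
      (a0 * b2 + a2 * b0 + a3 * b1 + b6 * a4 + b7 * a5 - a1 * b3 - b4 * a6 - b5 * a7)
      (a0 * b3 + a1 * b2 + a3 * b0 + b5 * a6 + b7 * a4 - a2 * b1 - b4 * a7 - b6 * a5)
      (b4 * a0 + a4 * b0 + a5 * b1 + a6 * b2 + a7 * b3 - b5 * a1 - b6 * a2 - b7 * a3)
      (b4 * a1 + b5 * a0 + b6 * a3 + a5 * b0 + a7 * b2 - b7 * a2 - a4 * b1 - a6 * b3)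
      (b4 * a2 + b6 * a0 + b7 * a1 + a5 * b3 + a6 * b0 - b5 * a3 - a4 * b2 - a7 * b1)
      (b4 * a3 + b5 * a2 + b7 * a0 + a6 * b1 + a7 * b0 - b6 * a1 - a4 * b3 - a5 * b2) := omul_eq _ _

theorem mkO_conj (a0 a1 a2 a3 a4 a5 a6 a7 : ℝ) : oconj (mkO a0 a1 a2 a3 a4 a5 a6 a7) =
    mkO a0 (-a1) (-a2) (-a3) (-a4) (-a5) (-a6) (-a7) := by
  simp only [oconj, mkO_one, mkO_inner, mkO_smul, mkO_sub]
  apply mkO_congr <;> ring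

theorem omul_add (x y z : Oct) : omul x (y + z) = omul x y + omul x z := by
  obtain ⟨x0, x1, x2, x3, x4, x5, x6, x7, rfl⟩ := mkO_eta x
  obtain ⟨y0, y1, y2, y3, y4, y5, y6, y7, rfl⟩ := mkO_eta y
  obtain ⟨z0, z1, z2, z3, z4, z5, z6, z7, rfl⟩ := mkO_eta z
  simp only [asc, mkO_zero, mkO_one, mkO_add, mkO_sub, mkO_smul, mkO_inner, mkO_mul, mkO_conj]
  apply mkO_congr <;> ring

theorem add_omul (x y z : Oct) : omul (x + y) z = omul x z + omul y z := by
  obtain ⟨x0, x1, x2, x3, x4, x5, x6, x7, rfl⟩ := mkO_eta x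
  obtain ⟨y0, y1, y2, y3, y4, y5, y6, y7, rfl⟩ := mkO_eta y
  obtain ⟨z0, z1, z2, z3, z4, z5, z6, z7, rfl⟩ := mkO_eta z
  simp only [asc, mkO_zero, mkO_one, mkO_add, mkO_sub, mkO_smul, mkO_inner, mkO_mul, mkO_conj]
  apply mkO_congr <;> ring

theorem omul_smul (r : ℝ) (x y : Oct) : omul x (r • y) = r • omul x y := by
  obtain ⟨x0, x1, x2, x3, x4, x5, x6, x7, rfl⟩ := mkO_eta x
  obtain ⟨y0, y1, y2, y3, y4, y5, y6, y7, rfl⟩ := mkO_eta y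
  simp only [asc, mkO_zero, mkO_one, mkO_add, mkO_sub, mkO_smul, mkO_inner, mkO_mul, mkO_conj]
  apply mkO_congr <;> ring

theorem smul_omul (r : ℝ) (x y : Oct) : omul (r • x) y = r • omul x y := by
  obtain ⟨x0, x1, x2, x3, x4, x5, x6, x7, rfl⟩ := mkO_eta x
  obtain ⟨y0, y1, y2, y3, y4, y5, y6, y7, rfl⟩ := mkO_eta y
  simp only [asc, mkO_zero, mkO_one, mkO_add, mkO_sub, mkO_smul, mkO_inner, mkO_mul, mkO_conj]
  apply mkO_congr <;> ring

theorem omul_sub (x y z : Oct) : omul x (y - z) = omul x y - omul x z := by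
  obtain ⟨x0, x1, x2, x3, x4, x5, x6, x7, rfl⟩ := mkO_eta x
  obtain ⟨y0, y1, y2, y3, y4, y5, y6, y7, rfl⟩ := mkO_eta y
  obtain ⟨z0, z1, z2, z3, z4, z5, z6, z7, rfl⟩ := mkO_eta z
  simp only [asc, mkO_zero, mkO_one, mkO_add, mkO_sub, mkO_smul, mkO_inner, mkO_mul, mkO_conj]
  apply mkO_congr <;> ring

theorem sub_omul (x y z : Oct) : omul (x - y) z = omul x z - omul y z := by
  obtain ⟨x0, x1, x2, x3, x4, x5, x6, x7, rfl⟩ := mkO_eta x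
  obtain ⟨y0, y1, y2, y3, y4, y5, y6, y7, rfl⟩ := mkO_eta y
  obtain ⟨z0, z1, z2, z3, z4, z5, z6, z7, rfl⟩ := mkO_eta z
  simp only [asc, mkO_zero, mkO_one, mkO_add, mkO_sub, mkO_smul, mkO_inner, mkO_mul, mkO_conj]
  apply mkO_congr <;> ring

theorem one_omul (x : Oct) : omul oone x = x := by
  obtain ⟨x0, x1, x2, x3, x4, x5, x6, x7, rfl⟩ := mkO_eta x
  simp only [asc, mkO_zero, mkO_one, mkO_add, mkO_sub, mkO_smul, mkO_inner, mkO_mul, mkO_conj]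
  apply mkO_congr <;> ring

theorem omul_one (x : Oct) : omul x oone = x := by
  obtain ⟨x0, x1, x2, x3, x4, x5, x6, x7, rfl⟩ := mkO_eta x
  simp only [asc, mkO_zero, mkO_one, mkO_add, mkO_sub, mkO_smul, mkO_inner, mkO_mul, mkO_conj]
  apply mkO_congr <;> ring

theorem oinner_add_left (x y z : Oct) : oinner (x + y) z = oinner x z + oinner y z := by
  obtain ⟨x0, x1, x2, x3, x4, x5, x6, x7, rfl⟩ := mkO_eta x
  obtain ⟨y0, y1, y2, y3, y4, y5, y6, y7, rfl⟩ := mkO_eta y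
  obtain ⟨z0, z1, z2, z3, z4, z5, z6, z7, rfl⟩ := mkO_eta z
  simp only [asc, mkO_zero, mkO_one, mkO_add, mkO_sub, mkO_smul, mkO_inner, mkO_mul, mkO_conj]
  ring

theorem oinner_sub_left (x y z : Oct) : oinner (x - y) z = oinner x z - oinner y z := by
  obtain ⟨x0, x1, x2, x3, x4, x5, x6, x7, rfl⟩ := mkO_eta x
  obtain ⟨y0, y1, y2, y3, y4, y5, y6, y7, rfl⟩ := mkO_eta y
  obtain ⟨z0, z1, z2, z3, z4, z5, z6, z7, rfl⟩ := mkO_eta z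
  simp only [asc, mkO_zero, mkO_one, mkO_add, mkO_sub, mkO_smul, mkO_inner, mkO_mul, mkO_conj]
  ring

theorem oinner_smul_left (r : ℝ) (x z : Oct) : oinner (r • x) z = r * oinner x z := by
  obtain ⟨x0, x1, x2, x3, x4, x5, x6, x7, rfl⟩ := mkO_eta x
  obtain ⟨z0, z1, z2, z3, z4, z5, z6, z7, rfl⟩ := mkO_eta z
  simp only [asc, mkO_zero, mkO_one, mkO_add, mkO_sub, mkO_smul, mkO_inner, mkO_mul, mkO_conj]
  ring

theorem oinner_comm (x y : Oct) : oinner x y = oinner y x := by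
  obtain ⟨x0, x1, x2, x3, x4, x5, x6, x7, rfl⟩ := mkO_eta x
  obtain ⟨y0, y1, y2, y3, y4, y5, y6, y7, rfl⟩ := mkO_eta y
  simp only [asc, mkO_zero, mkO_one, mkO_add, mkO_sub, mkO_smul, mkO_inner, mkO_mul, mkO_conj]
  ring

theorem oinner_self_pos {x : Oct} (hx : x ≠ 0) : 0 < oinner x x := by
  have h : oinner x x = ‖x.1‖ * ‖x.1‖ + ‖x.2‖ * ‖x.2‖ := by
    simp only [oinner, real_inner_self_eq_norm_mul_norm]
  rw [h]
  by_cases h1 : x.1 = 0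
  · have h2 : x.2 ≠ 0 := fun h2 => hx (Prod.ext h1 h2)
    have := norm_pos_iff.2 h2
    positivity
  · have := norm_pos_iff.2 h1
    positivity

theorem asc_add_right (x y z t : Oct) : asc x y (z + t) = asc x y z + asc x y t := by
  simp only [asc, omul_add]; abel

theorem asc_sub_right (x y z t : Oct) : asc x y (z - t) = asc x y z - asc x y t := by
  simp only [asc, omul_sub]; abel

theorem asc_smul_right (r : ℝ) (x y z : Oct) : asc x y (r • z) = r • asc x y z := by
  simp only [asc, omul_smul, smul_sub]

theorem asc_add_left (x y z t : Oct) : asc (x + y) z t = asc x z t + asc y z t := by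
  simp only [asc, add_omul]; abel

theorem asc_zero_right (x y : Oct) : asc x y 0 = 0 := by
  obtain ⟨x0, x1, x2, x3, x4, x5, x6, x7, rfl⟩ := mkO_eta x
  obtain ⟨y0, y1, y2, y3, y4, y5, y6, y7, rfl⟩ := mkO_eta y
  simp only [asc, mkO_zero, mkO_one, mkO_add, mkO_sub, mkO_smul, mkO_inner, mkO_mul, mkO_conj]
  apply mkO_congr <;> ring

theorem asc_one (x y : Oct) : asc x y oone = 0 := by
  simp [asc, omul_one]

theorem asc_flex (x y : Oct) : asc x y x = 0 := by
  obtain ⟨x0, x1, x2, x3, x4, x5, x6, x7, rfl⟩ := mkO_eta x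
  obtain ⟨y0, y1, y2, y3, y4, y5, y6, y7, rfl⟩ := mkO_eta y
  simp only [asc, mkO_zero, mkO_one, mkO_add, mkO_sub, mkO_smul, mkO_inner, mkO_mul, mkO_conj]
  apply mkO_congr <;> ring

theorem asc_alt (x y : Oct) : asc x y y = 0 := by
  obtain ⟨x0, x1, x2, x3, x4, x5, x6, x7, rfl⟩ := mkO_eta x
  obtain ⟨y0, y1, y2, y3, y4, y5, y6, y7, rfl⟩ := mkO_eta y
  simp only [asc, mkO_zero, mkO_one, mkO_add, mkO_sub, mkO_smul, mkO_inner, mkO_mul, mkO_conj]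
  apply mkO_congr <;> ring

set_option maxHeartbeats 4000000 in
theorem asc_mul (x y : Oct) : asc x y (omul x y) = 0 := by
  obtain ⟨x0, x1, x2, x3, x4, x5, x6, x7, rfl⟩ := mkO_eta x
  obtain ⟨y0, y1, y2, y3, y4, y5, y6, y7, rfl⟩ := mkO_eta y
  simp only [asc, mkO_zero, mkO_one, mkO_add, mkO_sub, mkO_smul, mkO_inner, mkO_mul, mkO_conj]
  apply mkO_congr <;> ring

set_option maxHeartbeats 4000000 in
theorem conj_sol (Y e p : Oct) : omul (omul Y e) (omul (oconj Y) p) =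
    omul Y (omul (omul Y e) p + omul e (omul (oconj Y) p) - omul Y (omul e p)) := by
  obtain ⟨Y0, Y1, Y2, Y3, Y4, Y5, Y6, Y7, rfl⟩ := mkO_eta Y
  obtain ⟨e0, e1, e2, e3, e4, e5, e6, e7, rfl⟩ := mkO_eta e
  obtain ⟨p0, p1, p2, p3, p4, p5, p6, p7, rfl⟩ := mkO_eta p
  simp only [asc, mkO_zero, mkO_one, mkO_add, mkO_sub, mkO_smul, mkO_inner, mkO_mul, mkO_conj]
  apply mkO_congr <;> ring

set_option maxHeartbeats 4000000 in
theorem asc_sq_aux (u e z : Oct) (hu : u.1.re = 0) (he : e.1.re = 0) (hz : z.1.re = 0) :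
    asc u e (asc u e z) = (-4 : ℝ) • ((oinner e e * oinner u u - oinner u e * oinner u e) • z
      - (oinner e e * oinner z u - oinner z e * oinner u e) • u
      - (oinner u u * oinner z e - oinner z u * oinner u e) • e
      - oinner z (omul u e + oinner u e • oone) • (omul u e + oinner u e • oone)) := by
  obtain ⟨u0, u1, u2, u3, u4, u5, u6, u7, rfl⟩ := mkO_eta u
  obtain ⟨e0, e1, e2, e3, e4, e5, e6, e7, rfl⟩ := mkO_eta e
  obtain ⟨z0, z1, z2, z3, z4, z5, z6, z7, rfl⟩ := mkO_eta z
  change u0 = 0 at hu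
  change e0 = 0 at he
  change z0 = 0 at hz
  subst hu he hz
  simp only [asc, mkO_zero, mkO_one, mkO_add, mkO_sub, mkO_smul, mkO_inner, mkO_mul, mkO_conj]
  apply mkO_congr <;> ring

theorem asc_sq (u e z : Oct) (hu : u.1.re = 0) (he : e.1.re = 0) (hz : z.1.re = 0)
    (hue : oinner u e = 0) (hze : oinner z e = 0) :
    asc u e (asc u e z) = (-4 : ℝ) • ((oinner e e * oinner u u) • z
      - (oinner e e * oinner z u) • u - oinner z (omul u e) • omul u e) := by
  rw [asc_sq_aux u e z hu he hz, hue, hze]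
  simp

theorem re_eq (x : Oct) : oinner x oone = x.1.re := by
  obtain ⟨x0, x1, x2, x3, x4, x5, x6, x7, rfl⟩ := mkO_eta x
  simp only [mkO_one, mkO_inner]
  simp [mkO]

theorem riesz (f : Oct →ₗ[ℝ] ℝ) : ∃ a : Oct, ∀ Y, f Y = oinner a Y := by
  refine ⟨mkO (f (mkO 1 0 0 0 0 0 0 0)) (f (mkO 0 1 0 0 0 0 0 0)) (f (mkO 0 0 1 0 0 0 0 0)) (f (mkO 0 0 0 1 0 0 0 0)) (f (mkO 0 0 0 0 1 0 0 0)) (f (mkO 0 0 0 0 0 1 0 0)) (f (mkO 0 0 0 0 0 0 1 0)) (f (mkO 0 0 0 0 0 0 0 1)), fun Y => ?_⟩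
  obtain ⟨Y0, Y1, Y2, Y3, Y4, Y5, Y6, Y7, rfl⟩ := mkO_eta Y
  have hY : mkO Y0 Y1 Y2 Y3 Y4 Y5 Y6 Y7 = Y0 • (mkO 1 0 0 0 0 0 0 0) + Y1 • (mkO 0 1 0 0 0 0 0 0) + Y2 • (mkO 0 0 1 0 0 0 0 0) + Y3 • (mkO 0 0 0 1 0 0 0 0) + Y4 • (mkO 0 0 0 0 1 0 0 0) + Y5 • (mkO 0 0 0 0 0 1 0 0) + Y6 • (mkO 0 0 0 0 0 0 1 0) + Y7 • (mkO 0 0 0 0 0 0 0 1) := by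
    simp only [mkO_smul, mkO_add]
    apply mkO_congr <;> ring
  rw [mkO_inner, hY]
  simp only [map_add, map_smul, smul_eq_mul]
  ring

def oinnerL (x : Oct) : Oct →ₗ[ℝ] ℝ where
  toFun y := oinner y x
  map_add' y z := oinner_add_left y z x
  map_smul' r y := oinner_smul_left r y x

theorem exists_perp (n : ℕ) (hn : n < 8) (v : Fin n → Oct) :
    ∃ u : Oct, u ≠ 0 ∧ ∀ i, oinner u (v i) = 0 := by
  have h : LinearMap.ker (LinearMap.pi (fun i => oinnerL (v i))) ≠ ⊥ := by
    apply LinearMap.ker_ne_bot_of_finrank_lt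
    simp [Quaternion.finrank_eq_four]
    omega
  obtain ⟨u, hu, hu0⟩ := Submodule.exists_mem_ne_zero_of_ne_bot h
  refine ⟨u, hu0, fun i => ?_⟩
  exact congrFun (LinearMap.mem_ker.1 hu) i

theorem inner_mul_right (w e u : Oct) (he : e.1.re = 0) :
    oinner (omul w e) u = - oinner w (omul u e) := by
  obtain ⟨w0, w1, w2, w3, w4, w5, w6, w7, rfl⟩ := mkO_eta w
  obtain ⟨e0, e1, e2, e3, e4, e5, e6, e7, rfl⟩ := mkO_eta e
  obtain ⟨u0, u1, u2, u3, u4, u5, u6, u7, rfl⟩ := mkO_eta u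
  change e0 = 0 at he
  subst he
  simp only [mkO_mul, mkO_inner]
  ring

theorem inner_mul_mul (w e u : Oct) :
    oinner (omul w e) (omul u e) = oinner w u * oinner e e := by
  obtain ⟨w0, w1, w2, w3, w4, w5, w6, w7, rfl⟩ := mkO_eta w
  obtain ⟨e0, e1, e2, e3, e4, e5, e6, e7, rfl⟩ := mkO_eta e
  obtain ⟨u0, u1, u2, u3, u4, u5, u6, u7, rfl⟩ := mkO_eta u
  simp only [asc, mkO_zero, mkO_one, mkO_add, mkO_sub, mkO_smul, mkO_inner, mkO_mul, mkO_conj]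
  ring

/-- The associator kernel. -/
theorem asc_ker (u e z : Oct) (he1 : oinner e oone = 0) (he : oinner e e = 1)
    (hu1 : oinner u oone = 0) (hz1 : oinner z oone = 0)
    (hue : oinner u e = 0) (hze : oinner z e = 0) (h : asc u e z = 0) :
    oinner u u • z = oinner z u • u + oinner z (omul u e) • omul u e := by
  have := asc_sq u e z (by rwa [← re_eq]) (by rwa [← re_eq]) (by rwa [← re_eq]) hue hze
  rw [h, asc_zero_right, he, one_mul, one_mul, eq_comm, smul_eq_zero] at this
  rcases this with h | h
  · norm_num at h
  · rw [sub_sub] at h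
    exact sub_eq_zero.1 h

theorem stmt17 (e : Oct) (he1 : oinner e oone = 0) (he : oinner e e = 1)
    (L F : Oct →ₗ[ℝ] Oct)
    (hLF : ∀ Y : Oct, omul (omul Y e) (L Y) = omul Y (F Y)) :
    ∃ a b p : Oct, ∀ Y : Oct,
      L Y = (oinner a Y) • oone + (oinner b Y) • e + omul (oconj Y) p := by
  have hre : e.1.re = 0 := by rwa [← re_eq]
  have h11 : oinner oone oone = 1 := by simp [mkO_one, mkO_inner]
  have h1e : oinner oone e = 0 := by rwa [oinner_comm]
  -- F in terms of L
  have hF1 : F oone = omul e (L oone) := by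
    have := hLF oone
    rw [one_omul, one_omul] at this
    exact this.symm
  have hF : ∀ Y, F Y = omul (omul Y e) (L oone) + omul e (L Y) - omul Y (omul e (L oone)) := by
    intro Y
    have h := hLF (Y + oone)
    have h2 := hLF Y
    have h3 := hLF oone
    simp only [map_add, add_omul, omul_add, one_omul] at h h2 h3
    rw [h2, h3, hF1] at h
    rw [eq_sub_iff_add_eq]
    have h4 : ∀ a b c d f : Oct, a + d + (b + c) = a + f + (omul Y (omul e (L oone)) + c) →
      f + omul Y (omul e (L oone)) = b + d := by
      intro a b c d f h
      have : b + d - (f + omul Y (omul e (L oone))) = 0 := by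
        have h' := sub_eq_zero.2 h
        rw [← h']; abel
      exact (sub_eq_zero.1 this).symm
    have h5 : ∀ a b c d f g: Oct, a + b + (c + d) = a + f + (g + d) → f + g = b + c := by
      intro a b c d f g h
      have h' := sub_eq_zero.2 h
      refine (sub_eq_zero.1 ?_).symm
      rw [← h']; abel
    first
      | (rw [add_comm (omul (omul Y e) (L oone))]; exact h5 _ _ _ _ _ _ h)
      | (refine h5 _ _ _ _ _ _ (Eq.trans ?_ (h.trans ?_)) <;> abel)
  -- reduce
  let M : Oct → Oct := fun Y => L Y - omul (oconj Y) (L oone)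
  have hMa : ∀ Y, asc Y e (M Y) = 0 := by
    intro Y
    have h := hLF Y
    rw [hF Y] at h
    have h2 := conj_sol Y e (L oone)
    simp only [omul_add, omul_sub] at h h2
    simp only [M, asc, omul_sub, h, h2]
    abel
  have hconj_add : ∀ Y Z, oconj (Y + Z) = oconj Y + oconj Z := by
    intro Y Z
    simp only [oconj, oinner_add_left, mul_add, add_smul]; abel
  have hconj_smul : ∀ (r : ℝ) Z, oconj (r • Z) = r • oconj Z := by
    intro r Z
    simp only [oconj, oinner_smul_left, smul_sub, smul_smul]
    congr 2; ring
  obtain ⟨u, hu0, hu⟩ := exists_perp 2 (by norm_num) ![oone, e]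
  have hu1 : oinner u oone = 0 := hu 0
  have hue : oinner u e = 0 := hu 1
  obtain ⟨w, hw0, hw⟩ := exists_perp 4 (by norm_num) ![oone, e, u, omul u e]
  have hw1 : oinner w oone = 0 := hw 0
  have hwe : oinner w e = 0 := hw 1
  have hwu : oinner w u = 0 := hw 2
  have hwc : oinner w (omul u e) = 0 := hw 3
  have hup := oinner_self_pos hu0
  have hwp := oinner_self_pos hw0
  have huc : oinner (omul u e) u = 0 := by
    have := inner_mul_right u e u hre
    rw [oinner_comm u (omul u e)] at this
    linarith
  have hcc : oinner (omul u e) (omul u e) = oinner u u := by rw [inner_mul_mul, he, mul_one]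
  -- common kernel
  have key : ∀ z, oinner z oone = 0 → oinner z e = 0 → asc u e z = 0 → asc w e z = 0 → z = 0 := by
    intro z hz1 hze hzu hzw
    have k1 := asc_ker u e z he1 he hu1 hz1 hue hze hzu
    have k2 := asc_ker w e z he1 he hw1 hz1 hwe hze hzw
    have a1 := congrArg (fun t => oinner t u) k2
    have a2 := congrArg (fun t => oinner t (omul u e)) k2
    simp only [oinner_add_left, oinner_smul_left, inner_mul_mul, hwu, hwc,
      inner_mul_right w e u hre] at a1 a2
    have b1 : oinner z u = 0 := by
      have : oinner w w * oinner z u = 0 := by rw [a1]; ring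
      exact (mul_eq_zero.1 this).resolve_left hwp.ne'
    have b2 : oinner z (omul u e) = 0 := by
      have : oinner w w * oinner z (omul u e) = 0 := by rw [a2]; ring
      exact (mul_eq_zero.1 this).resolve_left hwp.ne'
    rw [b1, b2, zero_smul, zero_smul, add_zero] at k1
    exact (smul_eq_zero.1 k1).resolve_left hup.ne'
  obtain ⟨α, hα⟩ : ∃ α, α = oinner (M u) u / oinner u u := ⟨_, rfl⟩
  obtain ⟨β, hβ⟩ : ∃ β, β = oinner (M u) (omul u e) / oinner u u := ⟨_, rfl⟩
  let M2 : Oct →ₗ[ℝ] Oct :=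
    { toFun := fun Y => M Y - α • Y - β • omul Y e
      map_add' := by
        intro Y Z
        simp only [M, map_add, hconj_add, add_omul, smul_add]; abel
      map_smul' := by
        intro r Y
        simp only [M, map_smul, hconj_smul, smul_omul, smul_sub, RingHom.id_apply,
          smul_comm r] }
  have hM2 : ∀ Y, M2 Y = M Y - α • Y - β • omul Y e := fun Y => rfl
  let N : Oct → Oct := fun Y => M2 Y - oinner (M2 Y) oone • oone - oinner (M2 Y) e • e
  have hN_add : ∀ Y Z, N (Y + Z) = N Y + N Z := by
    intro Y Z
    simp only [N, map_add, oinner_add_left, add_smul]; abel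
  have hNa : ∀ Y, asc Y e (N Y) = 0 := by
    intro Y
    simp only [N, hM2, asc_sub_right, asc_smul_right, asc_one, asc_alt, asc_flex, asc_mul, hMa,
      smul_zero, sub_zero]
  have hN1 : ∀ Y, oinner (N Y) oone = 0 := by
    intro Y
    simp only [N, oinner_sub_left, oinner_smul_left, h11, he1]; ring
  have hNe : ∀ Y, oinner (N Y) e = 0 := by
    intro Y
    simp only [N, oinner_sub_left, oinner_smul_left, h1e, he]; ring
  have hpol : ∀ Y Z, asc Y e (N Z) + asc Z e (N Y) = 0 := by
    intro Y Z
    have h := hNa (Y + Z)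
    rw [hN_add, asc_add_left, asc_add_right, asc_add_right, hNa, hNa] at h
    simpa using h
  have hNu : N u = 0 := by
    have k := asc_ker u e (N u) he1 he hu1 (hN1 u) hue (hNe u) (hNa u)
    have c1 : oinner (N u) u = 0 := by
      simp only [N, hM2, oinner_sub_left, oinner_smul_left, huc, oinner_comm oone u,
        oinner_comm e u, hu1, hue]
      rw [hα]; field_simp; ring
    have hec : oinner e (omul u e) = 0 := by
      have := inner_mul_mul oone e u
      rw [one_omul, oinner_comm oone u, hu1, zero_mul] at this
      exact this
    have h1c : oinner oone (omul u e) = 0 := by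
      have := inner_mul_right oone e u hre
      rw [one_omul, oinner_comm e u, hue] at this
      linarith
    have c2 : oinner (N u) (omul u e) = 0 := by
      simp only [N, hM2, oinner_sub_left, oinner_smul_left, hcc, oinner_comm u (omul u e), huc,
        hec, h1c]
      rw [hβ]; field_simp; ring
    rw [c1, c2, zero_smul, zero_smul, add_zero] at k
    exact (smul_eq_zero.1 k).resolve_left hup.ne'
  have hNuz : ∀ Z, asc u e (N Z) = 0 := by
    intro Z
    have h := hpol u Z
    rwa [hNu, asc_zero_right, add_zero] at h
  have hNw : N w = 0 := key _ (hN1 w) (hNe w) (hNuz w) (hNa w)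
  have hN0 : ∀ Z, N Z = 0 := by
    intro Z
    refine key _ (hN1 Z) (hNe Z) (hNuz Z) ?_
    have h := hpol w Z
    rwa [hNw, asc_zero_right, add_zero] at h
  obtain ⟨a, ha⟩ := riesz ((2 * α) • oinnerL oone + (oinnerL oone) ∘ₗ M2)
  obtain ⟨b, hb⟩ := riesz ((2 * β) • oinnerL oone + (oinnerL e) ∘ₗ M2)
  refine ⟨a, b, L oone - α • oone - β • e, fun Y => ?_⟩
  rw [← ha, ← hb]
  have ha' : ((2 * α) • oinnerL oone + (oinnerL oone) ∘ₗ M2) Y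
    = 2 * α * oinner Y oone + oinner (M2 Y) oone := rfl
  have hb' : ((2 * β) • oinnerL oone + (oinnerL e) ∘ₗ M2) Y
    = 2 * β * oinner Y oone + oinner (M2 Y) e := rfl
  rw [ha', hb']
  have h0 : M2 Y - oinner (M2 Y) oone • oone - oinner (M2 Y) e • e = 0 := hN0 Y
  generalize oinner (M2 Y) oone = r at *
  generalize oinner (M2 Y) e = s at *
  rw [hM2] at h0
  have hL : L Y = M Y + omul (oconj Y) (L oone) := by simp [M]
  have hM : M Y = α • Y + β • omul Y e + r • oone + s • e := by
    rw [← sub_eq_zero, ← h0]; abel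
  rw [hL, hM]
  simp only [omul_sub, omul_smul, omul_one]
  have hce : omul (oconj Y) e = (2 * oinner Y oone) • e - omul Y e := by
    simp only [oconj, sub_omul, smul_omul, one_omul]
  rw [hce]
  generalize omul (oconj Y) (L oone) = q
  generalize omul Y e = y
  simp only [oconj]
  module
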